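/- Soundness and completeness of the Font–Rius calculus: for every finite set Γ ∪ {α} of formulas, Γ ⊨_TML α if and only if the sequent Γ ⇒ α is provable in 𝔊. -/

import Mathlib

/-- A tetravalent modal algebra: a bounded distributive lattice with bottom `⊥` (= 0) and
top `⊤` (= ¬0), a De Morgan negation `compl` and a modal operator `box` satisfying
`□a ⊓ ¬a = 0` and `¬□a ⊓ a = ¬a ⊓ a`. -/
class TMA (α : Type*) extends DistribLattice α, BoundedOrder α where
  compl : α → α
  box : α → α
  compl_compl : ∀ a : α, compl (compl a) = a
  compl_sup : ∀ a b : α, compl (a ⊔ b) = compl a ⊓ compl b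
  compl_bot : compl (⊥ : α) = ⊤
  box_inf_compl : ∀ a : α, box a ⊓ compl a = ⊥
  compl_box_inf : ∀ a : α, compl (box a) ⊓ a = compl a ⊓ a
/-- Formulas built from propositional variables and the constant `⊥`
by the connectives `∧`, `∨`, `¬`, `□`. -/
inductive FormulaB : Type where
  | var : ℕ → FormulaB
  | bot : FormulaB
  | and : FormulaB → FormulaB → FormulaB
  | or : FormulaB → FormulaB → FormulaB
  | neg : FormulaB → FormulaB
  | box : FormulaB → FormulaB
deriving DecidableEq
/-- The Font–Rius sequent calculus 𝔊.  `Gder c Δ α` means the sequent `Δ ⇒ α` has a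
derivation; when `c = false` the cut rule is not allowed (cut-free derivability),
`Gder true` is plain derivability. -/
inductive Gder : Bool → Finset FormulaB → FormulaB → Prop where
  | ax (c : Bool) (α : FormulaB) : Gder c {α} α
  | modal (c : Bool) (α : FormulaB) : Gder c ∅ (α.or α.box.neg)
  | weak {c Δ α} (β : FormulaB) : Gder c Δ α → Gder c (insert β Δ) α
  | cut {Δ : Finset FormulaB} {α β : FormulaB} :
      Gder true Δ α → Gder true (insert α Δ) β → Gder true Δ β
  | andL {c Δ γ} (α β : FormulaB) :
      Gder c (insert α (insert β Δ)) γ → Gder c (insert (α.and β) Δ) γ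
  | andR {c Δ} {α β : FormulaB} : Gder c Δ α → Gder c Δ β → Gder c Δ (α.and β)
  | orL {c Δ γ} (α β : FormulaB) :
      Gder c (insert α Δ) γ → Gder c (insert β Δ) γ → Gder c (insert (α.or β) Δ) γ
  | orR1 {c Δ} {α : FormulaB} (β : FormulaB) : Gder c Δ α → Gder c Δ (α.or β)
  | orR2 {c Δ} (α : FormulaB) {β : FormulaB} : Gder c Δ β → Gder c Δ (α.or β)
  | negRule {c} {α β : FormulaB} : Gder c {α} β → Gder c {β.neg} α.neg
  | botRule {c Δ} (α : FormulaB) : Gder c Δ FormulaB.bot → Gder c Δ α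
  | nnL {c Δ β} (α : FormulaB) : Gder c (insert α Δ) β → Gder c (insert α.neg.neg Δ) β
  | nnR {c Δ} {α : FormulaB} : Gder c Δ α → Gder c Δ α.neg.neg
  | boxL {c Δ β} (α : FormulaB) :
      Gder c (insert α (insert α.neg Δ)) β → Gder c (insert α (insert α.box.neg Δ)) β
  | boxR {c Δ} {α : FormulaB} :
      Gder c Δ (α.and α.neg) → Gder c Δ (α.and α.box.neg)
/-- A homomorphism from the algebra of formulas to a TMA `A`: it commutes with
`∧, ∨, ¬, □` and sends `⊥` to `0`. -/
structure TMAHomB (A : Type) [TMA A] where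
  toFun : FormulaB → A
  map_bot : toFun FormulaB.bot = ⊥
  map_and : ∀ φ ψ : FormulaB, toFun (φ.and ψ) = toFun φ ⊓ toFun ψ
  map_or : ∀ φ ψ : FormulaB, toFun (φ.or ψ) = toFun φ ⊔ toFun ψ
  map_neg : ∀ φ : FormulaB, toFun φ.neg = TMA.compl (toFun φ)
  map_box : ∀ φ : FormulaB, toFun φ.box = TMA.box (toFun φ)

/-- Degree-preserving consequence over all tetravalent modal algebras:
`Γ ⊨_TML α` iff for every TMA `A` and every homomorphism `h` into `A`,
the infimum of `h '' Γ` is below `h α` (the empty infimum being `⊤ = 1`). -/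
def semTML (Γ : Finset FormulaB) (α : FormulaB) : Prop :=
  ∀ (A : Type) [TMA A], ∀ h : TMAHomB A, Γ.inf h.toFun ≤ h.toFun α

namespace TMA

variable {A : Type*} [TMA A]

theorem compl_le_compl {a b : A} (h : a ≤ b) : compl b ≤ compl a := by
  rw [← sup_eq_right.2 h, compl_sup]
  exact inf_le_left

theorem sup_compl_box (a : A) : a ⊔ compl (box a) = ⊤ := by
  rw [← compl_compl (a ⊔ compl (box a)), compl_sup, compl_compl, inf_comm, box_inf_compl,
    compl_bot]

end TMA

namespace Gder

theorem sound {c : Bool} {Δ : Finset FormulaB} {α : FormulaB} (d : Gder c Δ α) :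
    semTML Δ α := by
  intro A _ h
  induction d with
  | ax c α => simp
  | modal c α => simp [h.map_or, h.map_neg, h.map_box, TMA.sup_compl_box]
  | weak β _ ih => exact (Finset.inf_mono (Finset.subset_insert _ _)).trans ih
  | cut _ _ ih₁ ih₂ =>
    rw [Finset.inf_insert] at ih₂
    exact (le_inf ih₁ le_rfl).trans ih₂
  | andL α β _ ih => simpa [h.map_and, inf_assoc] using ih
  | andR _ _ ih₁ ih₂ =>
    rw [h.map_and]
    exact le_inf ih₁ ih₂
  | orL α β _ _ ih₁ ih₂ =>
    simp only [Finset.inf_insert] at ih₁ ih₂ ⊢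
    rw [h.map_or, inf_sup_right]
    exact sup_le ih₁ ih₂
  | orR1 β _ ih =>
    rw [h.map_or]
    exact ih.trans le_sup_left
  | orR2 α _ ih =>
    rw [h.map_or]
    exact ih.trans le_sup_right
  | negRule _ ih =>
    simp only [Finset.inf_singleton, h.map_neg] at ih ⊢
    exact TMA.compl_le_compl ih
  | botRule α _ ih =>
    rw [h.map_bot] at ih
    exact ih.trans bot_le
  | nnL α _ ih => simpa [h.map_neg, TMA.compl_compl] using ih
  | nnR _ ih => simpa [h.map_neg, TMA.compl_compl] using ih
  | boxL α _ ih =>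
    simp only [Finset.inf_insert, h.map_neg, h.map_box, ← inf_assoc] at ih ⊢
    rw [inf_comm (h.toFun α)] at ih ⊢
    rwa [TMA.compl_box_inf]
  | boxR _ ih =>
    simp only [h.map_and, h.map_neg, h.map_box] at ih ⊢
    rwa [inf_comm, TMA.compl_box_inf, inf_comm]

variable {c : Bool} {Δ Δ' : Finset FormulaB} {α β γ δ : FormulaB}

theorem mono (d : Gder c Δ α) (h : Δ ⊆ Δ') : Gder c Δ' α := by
  have key : ∀ s : Finset FormulaB, Gder c (s ∪ Δ) α := by
    intro s
    induction s using Finset.induction_on with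
    | empty => simpa using d
    | insert a s _ ih =>
      rw [Finset.insert_union]
      exact ih.weak a
  simpa [Finset.union_eq_left.2 h] using key Δ'

theorem of_mem (h : α ∈ Δ) : Gder c Δ α :=
  (ax c α).mono (Finset.singleton_subset_iff.2 h)

theorem cut_singleton (d : Gder true Δ α) (e : Gder true {α} β) : Gder true Δ β :=
  d.cut (e.mono (by simp))

theorem and_left : Gder c {α.and β} α := andL (Δ := ∅) α β (of_mem (by simp))

theorem and_right : Gder c {α.and β} β := andL (Δ := ∅) α β (of_mem (by simp))

theorem or_left : Gder c {α} (α.or β) := orR1 β (ax c α)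

theorem or_right : Gder c {β} (α.or β) := orR2 α (ax c β)

theorem or_elim (d : Gder c {α} γ) (e : Gder c {β} γ) : Gder c {α.or β} γ :=
  orL (Δ := ∅) α β d e

theorem or_and_distrib :
    Gder c {(α.or β).and (α.or γ)} (α.or (β.and γ)) := by
  refine andL (Δ := ∅) _ _ (orL _ _ (orR1 _ (of_mem (by simp))) ?_)
  rw [Finset.insert_comm]
  exact orL _ _ (orR1 _ (of_mem (by simp)))
    (orR2 _ (andR (of_mem (by simp)) (of_mem (by simp))))

theorem bot_elim : Gder c {FormulaB.bot} α := botRule α (ax c _)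

theorem neg_neg_elim : Gder c {α.neg.neg} α := nnL (Δ := ∅) α (ax c α)

theorem neg_neg_intro : Gder c {α} α.neg.neg := nnR (ax c α)

theorem neg_bot : Gder true Δ FormulaB.bot.neg :=
  ((modal true FormulaB.bot).cut_singleton
    (or_elim bot_elim (negRule bot_elim))).mono (Finset.empty_subset _)

theorem neg_or : Gder true {(α.or β).neg} (α.neg.and β.neg) :=
  andR (negRule or_left) (negRule or_right)

theorem neg_and_neg : Gder true {α.neg.and β.neg} (α.or β).neg :=
  neg_neg_intro.cut_singleton (negRule (or_elim
    (neg_neg_intro.cut_singleton (negRule and_left))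
    (neg_neg_intro.cut_singleton (negRule and_right))))

theorem box_and_neg : Gder true {α.box.and α.neg} FormulaB.bot := by
  have h : Gder true {α.box.and α.neg} (α.neg.and α.box.neg.neg) :=
    andR and_right (nnR and_left)
  refine (h.cut_singleton neg_and_neg).cut_singleton
    (.cut_singleton (negRule (α := FormulaB.bot.neg) ?_) neg_neg_elim)
  exact (modal true α).mono (Finset.empty_subset _)

theorem neg_box_and : Gder c {α.box.neg.and α} (α.neg.and α) := by
  refine andL (Δ := ∅) _ _ ?_
  rw [Finset.insert_comm]
  exact boxL α (andR (of_mem (by simp)) (of_mem (by simp)))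

theorem neg_and_self : Gder true {α.neg.and α} (α.box.neg.and α) :=
  (boxR (andR and_right and_left)).cut_singleton (andR and_right and_left)

end Gder

/-- Interderivability of formulas. -/
def interderivable : Setoid FormulaB where
  r α β := Gder true {α} β ∧ Gder true {β} α
  iseqv :=
    ⟨fun α => ⟨.ax _ α, .ax _ α⟩, fun h => ⟨h.2, h.1⟩,
      fun h k => ⟨h.1.cut_singleton k.1, k.2.cut_singleton h.2⟩⟩

/-- The Lindenbaum–Tarski algebra of the Font–Rius calculus. -/
def Lindenbaum : Type := Quotient interderivable

namespace Lindenbaum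

/-- The class of a formula. -/
def mk (α : FormulaB) : Lindenbaum := Quotient.mk interderivable α

theorem ind {p : Lindenbaum → Prop} (h : ∀ α, p (mk α)) (x : Lindenbaum) : p x :=
  Quotient.ind h x

instance : PartialOrder Lindenbaum where
  le := Quotient.lift₂ (fun α β => Gder true {α} β) fun _ _ _ _ h k => propext
    ⟨fun d => (h.2.cut_singleton d).cut_singleton k.1,
      fun d => (h.1.cut_singleton d).cut_singleton k.2⟩
  le_refl := ind fun α => .ax _ α
  le_trans := ind fun _ => ind fun _ => ind fun _ h k => Gder.cut_singleton h k
  le_antisymm := ind fun _ => ind fun _ h k => Quotient.sound ⟨h, k⟩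

theorem mk_le_mk {α β : FormulaB} : mk α ≤ mk β ↔ Gder true {α} β := Iff.rfl

theorem mk_eq_mk {α β : FormulaB} : mk α = mk β ↔ Gder true {α} β ∧ Gder true {β} α :=
  Quotient.eq (r := interderivable)

instance : DistribLattice Lindenbaum where
  inf := Quotient.map₂ FormulaB.and fun _ _ h _ _ k =>
    ⟨.andR (Gder.and_left.cut_singleton h.1) (Gder.and_right.cut_singleton k.1),
      .andR (Gder.and_left.cut_singleton h.2) (Gder.and_right.cut_singleton k.2)⟩
  sup := Quotient.map₂ FormulaB.or fun _ _ h _ _ k =>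
    ⟨.or_elim (.orR1 _ h.1) (.orR2 _ k.1), .or_elim (.orR1 _ h.2) (.orR2 _ k.2)⟩
  inf_le_left := ind fun _ => ind fun _ => Gder.and_left
  inf_le_right := ind fun _ => ind fun _ => Gder.and_right
  le_inf := ind fun _ => ind fun _ => ind fun _ h k => Gder.andR h k
  le_sup_left := ind fun _ => ind fun _ => Gder.or_left
  le_sup_right := ind fun _ => ind fun _ => Gder.or_right
  sup_le := ind fun _ => ind fun _ => ind fun _ h k => Gder.or_elim h k
  le_sup_inf := ind fun _ => ind fun _ => ind fun _ => Gder.or_and_distrib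

instance : BoundedOrder Lindenbaum where
  top := mk FormulaB.bot.neg
  bot := mk FormulaB.bot
  le_top := ind fun _ => Gder.neg_bot
  bot_le := ind fun _ => Gder.bot_elim

theorem mk_and (α β : FormulaB) : mk (α.and β) = mk α ⊓ mk β := rfl

theorem mk_or (α β : FormulaB) : mk (α.or β) = mk α ⊔ mk β := rfl

theorem mk_neg_box_inf (α : FormulaB) : mk α.box.neg ⊓ mk α = mk α.neg ⊓ mk α :=
  mk_eq_mk.2 ⟨Gder.neg_box_and, Gder.neg_and_self⟩

theorem mk_neg_box_sup (α : FormulaB) : mk α.box.neg ⊔ mk α = ⊤ := by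
  rw [sup_comm, ← mk_or]
  exact top_le_iff.1 ((Gder.modal true α).mono (Finset.empty_subset _))

theorem mk_neg_congr {α β : FormulaB} (h : mk α = mk β) : mk α.neg = mk β.neg :=
  mk_eq_mk.2 ⟨.negRule (mk_eq_mk.1 h).2, .negRule (mk_eq_mk.1 h).1⟩

theorem mk_neg_neg (α : FormulaB) : mk α.neg.neg = mk α :=
  mk_eq_mk.2 ⟨Gder.neg_neg_elim, Gder.neg_neg_intro⟩

/-- `¬□α` is determined by its meet and join with `α`, so `□` respects interderivability. -/
theorem mk_box_congr {α β : FormulaB} (h : mk α = mk β) : mk α.box = mk β.box := by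
  have key : mk α.box.neg = mk β.box.neg := by
    apply eq_of_inf_eq_sup_eq (a := mk α)
    · rw [mk_neg_box_inf, mk_neg_congr h, h, mk_neg_box_inf]
    · rw [mk_neg_box_sup, h, mk_neg_box_sup]
  rw [← mk_neg_neg α.box, mk_neg_congr key, mk_neg_neg]

instance : TMA Lindenbaum where
  compl := Quotient.map FormulaB.neg fun _ _ h => ⟨.negRule h.2, .negRule h.1⟩
  box := Quotient.map FormulaB.box fun _ _ h => mk_eq_mk.1 (mk_box_congr (mk_eq_mk.2 h))
  compl_compl := ind mk_neg_neg
  compl_sup := ind fun _ => ind fun _ => mk_eq_mk.2 ⟨Gder.neg_or, Gder.neg_and_neg⟩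
  compl_bot := rfl
  box_inf_compl := ind fun _ => le_bot_iff.1 Gder.box_and_neg
  compl_box_inf := ind mk_neg_box_inf

/-- The canonical homomorphism from formulas to the Lindenbaum–Tarski algebra. -/
def mkHom : TMAHomB Lindenbaum where
  toFun := mk
  map_bot := rfl
  map_and _ _ := rfl
  map_or _ _ := rfl
  map_neg _ := rfl
  map_box _ := rfl

theorem exists_mk_eq_inf (Γ : Finset FormulaB) : ∃ φ, mk φ = Γ.inf mk ∧ Gder true Γ φ := by
  induction Γ using Finset.induction_on with
  | empty => exact ⟨FormulaB.bot.neg, rfl, Gder.neg_bot⟩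
  | insert α Γ _ ih =>
    obtain ⟨φ, hφ, d⟩ := ih
    exact ⟨α.and φ, by rw [Finset.inf_insert, mk_and, hφ],
      .andR (.of_mem (Finset.mem_insert_self _ _)) (d.weak α)⟩

end Lindenbaum

/-- Soundness and completeness of the Font–Rius calculus 𝔊 with respect to the
degree-preserving consequence over tetravalent modal algebras. -/
theorem fontRius_soundness_completeness (Γ : Finset FormulaB) (α : FormulaB) :
    semTML Γ α ↔ Gder true Γ α := by
  refine ⟨fun h => ?_, Gder.sound⟩
  obtain ⟨φ, hφ, d⟩ := Lindenbaum.exists_mk_eq_inf Γ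
  have hle : Γ.inf Lindenbaum.mk ≤ Lindenbaum.mk α := h Lindenbaum Lindenbaum.mkHom
  rw [← hφ, Lindenbaum.mk_le_mk] at hle
  exact d.cut_singleton hle
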